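/- Let Γ be a connected core multigraph. Then every maximal flag of core subgraphs ∅ ⊊ Γ₁ ⊊ Γ₂ ⊊ ⋯ ⊊ Γ_n = Γ (a strictly increasing chain of core subgraphs that admits no refinement by further core subgraphs) has exactly n = h1(Γ) terms. -/

import Mathlib

open scoped Classical

/-- A multigraph: finite sets of vertices and edges, where each edge is
assigned an unordered pair of (possibly equal) endpoints. -/
structure Multigraph where
  V : Type
  E : Type
  finV : Finite V
  finE : Finite E
  ends : E → Sym2 V

attribute [instance] Multigraph.finV Multigraph.finE

namespace Multigraph

variable (G : Multigraph)

/-- `v` and `w` are joined by some edge belonging to `μ`. -/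
def Step (μ : Set G.E) (v w : G.V) : Prop :=
  ∃ e ∈ μ, G.ends e = s(v, w)

/-- Connectivity with respect to the edge set `μ`, as a setoid on all vertices. -/
def connSetoid (μ : Set G.E) : Setoid G.V :=
  Relation.EqvGen.setoid (G.Step μ)

/-- The number of connected components of the spanning subgraph `(V(G), μ)`. -/
noncomputable def h0 (μ : Set G.E) : ℕ :=
  Nat.card (Quotient (G.connSetoid μ))

/-- The first Betti number `h1 = |E| − |V| + h0` of the subgraph with edge set `μ`.
(Isolated vertices contribute equally to `|V|` and to `h0`, so this agrees with
the first Betti number of the subgraph whose vertices are the endpoints of the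
edges in `μ`.) -/
noncomputable def h1 (μ : Set G.E) : ℤ :=
  (Nat.card μ : ℤ) - (Nat.card G.V : ℤ) + (G.h0 μ : ℤ)

/-- A subgraph (identified with its edge set) is core (1PI): removing any one of
its edges lowers `h1`. -/
def IsCore (μ : Set G.E) : Prop :=
  ∀ e ∈ μ, G.h1 (μ \ {e}) < G.h1 μ

/-- The multigraph is connected. -/
def Connected : Prop := G.h0 Set.univ = 1

/-- The contraction `Γ//γ`: each connected component of `γ` is contracted to a
single vertex and the edges of `γ` are deleted. -/
def contract (γ : Set G.E) : Multigraph where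
  V := Quotient (G.connSetoid γ)
  E := {e : G.E // e ∉ γ}
  finV := Quotient.finite _
  finE := Subtype.finite
  ends e := (G.ends e.1).map (Quotient.mk (G.connSetoid γ))

/-- The subgraph with edge set `γ`, as a multigraph in its own right. -/
def restrict (γ : Set G.E) : Multigraph where
  V := G.V
  E := γ
  finV := G.finV
  finE := Subtype.finite
  ends e := G.ends e.1

/-- `F` is a spanning forest: it is acyclic and consists of one spanning tree of
each connected component (equivalently, it induces the same connectivity
relation as the full edge set). -/
def IsSpanningForest (F : Set G.E) : Prop :=
  G.h1 F = 0 ∧ G.connSetoid F = G.connSetoid Set.univ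

/-- The first Kirchhoff–Symanzik (graph) polynomial
`ψ(Γ) = Σ_F Π_{e ∉ F} A_e`, the sum over spanning forests. -/
noncomputable def kirchhoff : MvPolynomial G.E ℤ :=
  ∑ᶠ F ∈ {F : Set G.E | G.IsSpanningForest F}, ∏ᶠ e ∈ Fᶜ, MvPolynomial.X e

/-- Euclidean dot product on `ℝ^D`. -/
noncomputable def dot {D : ℕ} (x y : Fin D → ℝ) : ℝ := ∑ i, x i * y i

/-- The total momentum entering the connected component `c` of `(V(G), F)`. -/
noncomputable def momentumOf {D : ℕ} (q : G.V → Fin D → ℝ) (F : Set G.E)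
    (c : Quotient (G.connSetoid F)) : Fin D → ℝ :=
  ∑ᶠ v ∈ {v : G.V | Quotient.mk (G.connSetoid F) v = c}, q v

/-- The second Kirchhoff–Symanzik polynomial
`φ(Γ) = Σ_{(T₁,T₂)} (Q(T₁)·Q(T₂)) Π_{e ∉ T₁∪T₂} A_e`, the sum over spanning
2-forests, i.e. acyclic edge sets `F` with exactly two connected components
`T₁, T₂` (jointly covering all vertices); `Q(T_i)` is the sum of the momenta
over the vertices of `T_i`, and `Q(T₁)·Q(T₂)` is computed symmetrically via
`Q(T₁)·Q(T₂) = ((Q(T₁)+Q(T₂))² − Q(T₁)² − Q(T₂)²)/2`. -/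
noncomputable def symanzik2 (D : ℕ) (q : G.V → Fin D → ℝ) : MvPolynomial G.E ℝ :=
  ∑ᶠ F ∈ {F : Set G.E | G.h1 F = 0 ∧ G.h0 F = 2},
    MvPolynomial.C
      ((dot (∑ᶠ v, q v) (∑ᶠ v, q v) -
          ∑ᶠ c : Quotient (G.connSetoid F), dot (G.momentumOf q F c) (G.momentumOf q F c)) / 2) *
      ∏ᶠ e ∈ Fᶜ, MvPolynomial.X e

/-- External momenta pass to the contraction `Γ//γ` by assigning to each vertex
(i.e. each connected component of `γ`, or untouched vertex) the sum of the
momenta of the vertices identified to it. -/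
noncomputable def contractMomenta (γ : Set G.E) {D : ℕ} (q : G.V → Fin D → ℝ) :
    (G.contract γ).V → Fin D → ℝ :=
  fun c => ∑ᶠ v ∈ {v : G.V | Quotient.mk (G.connSetoid γ) v = c}, q v

/-- A flag of core subgraphs of the subgraph `γ`: a chain (under inclusion) of
nonempty core subgraphs of `γ`, having `γ` itself as its largest member.  We
encode a flag as its set of members. -/
def IsCoreFlagIn (γ : Set G.E) (F : Set (Set G.E)) : Prop :=
  γ ∈ F ∧ ∅ ∉ F ∧ (∀ δ ∈ F, δ ⊆ γ ∧ G.IsCore δ) ∧ IsChain (· ⊆ ·) F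

/-- A maximal flag of core subgraphs of `γ`: one admitting no refinement. -/
def IsMaximalCoreFlagIn (γ : Set G.E) (F : Set (Set G.E)) : Prop :=
  G.IsCoreFlagIn γ F ∧ ∀ F' : Set (Set G.E), G.IsCoreFlagIn γ F' → F ⊆ F' → F' = F

/-- A flag of core subgraphs of `Γ`. -/
def IsCoreFlag (F : Set (Set G.E)) : Prop := G.IsCoreFlagIn Set.univ F

/-- A maximal flag of core subgraphs of `Γ`. -/
def IsMaximalCoreFlag (F : Set (Set G.E)) : Prop := G.IsMaximalCoreFlagIn Set.univ F

end Multigraph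

namespace Multigraph

variable {G : Multigraph} {μ ν : Set G.E} {e : G.E} {a b : G.V}

theorem connSetoid_le {s : Setoid G.V} (h : ∀ v w, G.Step μ v w → s v w) :
    G.connSetoid μ ≤ s :=
  Setoid.eqvGen_le h

theorem connSetoid_of_step {v w : G.V} (h : G.Step μ v w) : G.connSetoid μ v w :=
  Relation.EqvGen.rel _ _ h

theorem connSetoid_mono (h : μ ⊆ ν) : G.connSetoid μ ≤ G.connSetoid ν :=
  connSetoid_le fun _ _ ⟨e, he, hs⟩ => connSetoid_of_step ⟨e, h he, hs⟩

theorem h0_le_of_connSetoid_le (h : G.connSetoid μ ≤ G.connSetoid ν) : G.h0 ν ≤ G.h0 μ :=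
  Nat.card_le_card_of_surjective (Quotient.map id fun _ _ hvw => h hvw) fun q =>
    q.inductionOn fun v => ⟨Quotient.mk _ v, rfl⟩

theorem h0_anti (h : μ ⊆ ν) : G.h0 ν ≤ G.h0 μ :=
  h0_le_of_connSetoid_le (connSetoid_mono h)

/-- The setoid obtained from `s` by merging the classes of `a` and `b`. -/
def mergeSetoid {V : Type*} (s : Setoid V) (a b : V) : Setoid V where
  r v w := s v w ∨ (s v a ∨ s v b) ∧ (s w a ∨ s w b)
  iseqv :=
    { refl := fun v => Or.inl (s.refl v)
      symm := fun h => h.imp s.symm And.symm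
      trans := by
        rintro x y z (h | ⟨h, h'⟩) (k | ⟨k, k'⟩)
        · exact Or.inl (s.trans h k)
        · exact Or.inr ⟨k.imp (s.trans h) (s.trans h), k'⟩
        · exact Or.inr ⟨h, h'.imp (s.trans (s.symm k)) (s.trans (s.symm k))⟩
        · exact Or.inr ⟨h, k'⟩ }

theorem connSetoid_le_mergeSetoid (hab : G.ends e = s(a, b)) :
    G.connSetoid μ ≤ mergeSetoid (G.connSetoid (μ \ {e})) a b := by
  refine connSetoid_le ?_
  rintro v w ⟨f, hf, hs⟩
  by_cases hfe : f = e
  · subst hfe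
    rw [hab, Sym2.eq_iff] at hs
    right
    rcases hs with ⟨rfl, rfl⟩ | ⟨rfl, rfl⟩
    · exact ⟨Or.inl (Setoid.refl' _ _), Or.inr (Setoid.refl' _ _)⟩
    · exact ⟨Or.inr (Setoid.refl' _ _), Or.inl (Setoid.refl' _ _)⟩
  · exact Or.inl (connSetoid_of_step ⟨f, ⟨hf, hfe⟩, hs⟩)

theorem h0_diff_singleton_le : G.h0 (μ \ {e}) ≤ G.h0 μ + 1 := by
  obtain ⟨a, b, hab⟩ : ∃ a b, G.ends e = s(a, b) := (G.ends e).ind fun a b => ⟨a, b, rfl⟩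
  set s := G.connSetoid (μ \ {e})
  let f : Quotient s → Option (Quotient (G.connSetoid μ)) := fun q =>
    if q = Quotient.mk s a then none
    else some (Quotient.map id (fun _ _ h => connSetoid_mono Set.sdiff_subset h) q)
  have hf : Function.Injective f := by
    intro p q
    induction p, q using Quotient.inductionOn₂ with | _ v w
    intro h
    by_cases hv : Quotient.mk s v = Quotient.mk s a <;> by_cases hw : Quotient.mk s w = Quotient.mk s a
    · rw [hv, hw]
    · simp [f, hv, hw] at h
    · simp [f, hv, hw] at h
    · simp only [f, hv, hw, if_false, Option.some.injEq] at h
      have hvw : G.connSetoid μ v w := Quotient.exact h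
      have hva : ¬ s v a := fun h => hv (Quotient.sound h)
      have hwa : ¬ s w a := fun h => hw (Quotient.sound h)
      apply Quotient.sound
      rcases connSetoid_le_mergeSetoid hab hvw with h | ⟨h, h'⟩
      · exact h
      · exact s.trans (h.resolve_left hva) (s.symm (h'.resolve_left hwa))
  exact (Nat.card_le_card_of_injective f hf).trans_eq Finite.card_option

/-- Removing `e` does not create a new component iff the ends of `e` stay connected. -/
theorem h0_diff_singleton_le_iff (he : e ∈ μ) (hab : G.ends e = s(a, b)) :
    G.h0 (μ \ {e}) ≤ G.h0 μ ↔ G.connSetoid (μ \ {e}) a b := by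
  constructor
  · intro h
    let f : Quotient (G.connSetoid (μ \ {e})) → Quotient (G.connSetoid μ) :=
      Quotient.map id fun _ _ h => connSetoid_mono Set.sdiff_subset h
    have hf : Function.Surjective f := fun q => q.inductionOn fun v => ⟨Quotient.mk _ v, rfl⟩
    have hinj := (hf.bijective_of_nat_card_le h).injective
    refine Quotient.exact (hinj (a₁ := Quotient.mk _ a) (a₂ := Quotient.mk _ b) (Quotient.sound ?_))
    exact connSetoid_of_step ⟨e, he, hab⟩
  · intro h
    refine h0_le_of_connSetoid_le ((connSetoid_le_mergeSetoid hab).trans ?_)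
    have key : ∀ {v}, G.connSetoid (μ \ {e}) v a ∨ G.connSetoid (μ \ {e}) v b →
        G.connSetoid (μ \ {e}) v a := fun hv => hv.elim id fun hv => (G.connSetoid _).trans hv ((G.connSetoid _).symm h)
    rintro v w (hvw | ⟨hv, hw⟩)
    · exact hvw
    · exact (G.connSetoid _).trans (key hv) ((G.connSetoid _).symm (key hw))

theorem h1_diff_singleton (he : e ∈ μ) :
    G.h1 (μ \ {e}) = G.h1 μ - 1 - G.h0 μ + G.h0 (μ \ {e}) := by
  have h : Nat.card ↥(μ \ {e}) + 1 = Nat.card μ := Set.ncard_sdiff_singleton_add_one he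
  unfold h1
  omega

theorem h1_diff_singleton_lt_iff (he : e ∈ μ) :
    G.h1 (μ \ {e}) < G.h1 μ ↔ G.h0 (μ \ {e}) ≤ G.h0 μ := by
  have := h1_diff_singleton he
  omega

theorem h1_diff_singleton_le : G.h1 (μ \ {e}) ≤ G.h1 μ := by
  by_cases he : e ∈ μ
  · have := h1_diff_singleton he
    have := h0_diff_singleton_le (μ := μ) (e := e)
    omega
  · rw [Set.sdiff_singleton_eq_self he]

theorem h1_diff_singleton_of_lt (he : e ∈ μ) (h : G.h1 (μ \ {e}) < G.h1 μ) :
    G.h1 (μ \ {e}) = G.h1 μ - 1 := by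
  have := h1_diff_singleton he
  have : G.h0 μ ≤ G.h0 (μ \ {e}) := h0_anti Set.sdiff_subset
  omega

theorem h1_mono (h : μ ⊆ ν) : G.h1 μ ≤ G.h1 ν := by
  suffices ∀ s : Set G.E, G.h1 μ ≤ G.h1 (s ∪ μ) by simpa [Set.union_eq_left.2 h] using this ν
  intro s
  induction s, s.toFinite using Set.Finite.induction_on with
  | empty => simp
  | @insert e s _ _ ih =>
    by_cases he : e ∈ s ∪ μ
    · rwa [Set.insert_union, Set.insert_eq_of_mem he]
    · refine ih.trans ?_
      simpa [Set.insert_union, Set.insert_sdiff_self_of_notMem he] using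
        h1_diff_singleton_le (G := G) (μ := insert e s ∪ μ) (e := e)

/-- An edge that is not a bridge of a subgraph is not a bridge of a larger one. -/
theorem h1_diff_singleton_lt_mono (h : μ ⊆ ν) (he : e ∈ μ) (hlt : G.h1 (μ \ {e}) < G.h1 μ) :
    G.h1 (ν \ {e}) < G.h1 ν := by
  obtain ⟨a, b, hab⟩ : ∃ a b, G.ends e = s(a, b) := (G.ends e).ind fun a b => ⟨a, b, rfl⟩
  rw [h1_diff_singleton_lt_iff he, h0_diff_singleton_le_iff he hab] at hlt
  rw [h1_diff_singleton_lt_iff (h he), h0_diff_singleton_le_iff (h he) hab]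
  exact connSetoid_mono (Set.sdiff_subset_sdiff_left h) hlt

theorem isCore_empty : G.IsCore ∅ := fun _ he => he.elim

theorem h1_empty : G.h1 ∅ = 0 := by
  have h : G.h0 ∅ = Nat.card G.V :=
    (Nat.card_eq_of_bijective (Quotient.mk (G.connSetoid ∅)) ⟨fun v w hvw => by
      have : G.connSetoid ∅ ≤ ⊥ := connSetoid_le fun _ _ ⟨_, he, _⟩ => he.elim
      exact this (Quotient.exact hvw), Quotient.mk_surjective⟩).symm
  simp [h1, h]

theorem IsCore.h1_lt (hν : G.IsCore ν) (h : μ ⊂ ν) : G.h1 μ < G.h1 ν := by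
  obtain ⟨e, he, heμ⟩ := Set.exists_of_ssubset h
  exact (h1_mono (Set.subset_sdiff_singleton h.subset heμ)).trans_lt (hν e he)

theorem IsCore.exists_isCore_h1_eq_sub_one (hμ : G.IsCore μ) (hν : G.IsCore ν) (h : μ ⊂ ν) :
    ∃ δ, G.IsCore δ ∧ μ ⊆ δ ∧ δ ⊆ ν ∧ G.h1 δ = G.h1 ν - 1 := by
  obtain ⟨e, he, heμ⟩ := Set.exists_of_ssubset h
  obtain ⟨δ, hδ⟩ := (Set.toFinite {δ | μ ⊆ δ ∧ δ ⊆ ν ∧ G.h1 δ = G.h1 ν - 1}).exists_minimal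
    ⟨ν \ {e}, Set.subset_sdiff_singleton h.subset heμ, Set.sdiff_subset,
      h1_diff_singleton_of_lt he (hν e he)⟩
  obtain ⟨hμδ, hδν, h1δ⟩ := hδ.prop
  refine ⟨δ, fun f hf => ?_, hμδ, hδν, h1δ⟩
  by_cases hfμ : f ∈ μ
  · exact h1_diff_singleton_lt_mono hμδ hfμ (hμ f hfμ)
  · refine lt_of_le_of_ne h1_diff_singleton_le fun heq => ?_
    exact (hδ.le_of_le ⟨Set.subset_sdiff_singleton hμδ hfμ, Set.sdiff_subset.trans hδν,
      heq.trans h1δ⟩ Set.sdiff_subset hf).2 rfl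

theorem IsCoreFlagIn.injOn_h1 {F : Set (Set G.E)} (hF : G.IsCoreFlagIn ν F) :
    Set.InjOn G.h1 F := by
  obtain ⟨-, -, hc, hchain⟩ := hF
  intro γ hγ δ hδ h
  rcases hchain.total hγ hδ with hle | hle <;> by_contra hne
  · exact ((hc δ hδ).2.h1_lt (hle.ssubset_of_ne hne)).ne h
  · exact ((hc γ hγ).2.h1_lt (hle.ssubset_of_ne (Ne.symm hne))).ne h.symm

theorem IsMaximalCoreFlagIn.image_h1 {F : Set (Set G.E)} (hF : G.IsMaximalCoreFlagIn ν F) :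
    G.h1 '' F = Set.Icc 1 (G.h1 ν) := by
  obtain ⟨⟨hν, hempty, hc, hchain⟩, hmax⟩ := hF
  refine Set.Subset.antisymm ?_ ?_
  · rintro _ ⟨δ, hδ, rfl⟩
    refine ⟨?_, h1_mono (hc δ hδ).1⟩
    have hne : δ ≠ ∅ := fun h => hempty (h ▸ hδ)
    have := (hc δ hδ).2.h1_lt (Set.empty_ssubset.2 (Set.nonempty_iff_ne_empty.2 hne))
    rw [h1_empty] at this
    omega
  rintro k ⟨hk1, hkν⟩
  obtain ⟨γ, hγ⟩ := (Set.toFinite {γ | γ ∈ F ∧ k ≤ G.h1 γ}).exists_minimal ⟨ν, hν, hkν⟩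
  obtain ⟨hγF, hkγ⟩ := hγ.prop
  have hγle : ∀ δ ∈ F, k ≤ G.h1 δ → γ ⊆ δ := fun δ hδ hkδ =>
    (hchain.total hγF hδ).elim id (hγ.le_of_le ⟨hδ, hkδ⟩)
  obtain ⟨δ, hδ⟩ := (Set.toFinite {δ | (δ = ∅ ∨ δ ∈ F) ∧ G.h1 δ < k}).exists_maximal
    ⟨∅, Or.inl rfl, by rw [h1_empty]; omega⟩
  obtain ⟨hδF, hδk⟩ := hδ.prop
  have hleδ : ∀ η ∈ F, G.h1 η < k → η ⊆ δ := by
    intro η hη hηk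
    rcases hδF with rfl | hδF
    · exact hδ.le_of_ge ⟨Or.inr hη, hηk⟩ (Set.empty_subset η)
    · exact (hchain.total hη hδF).elim id (hδ.le_of_ge ⟨Or.inr hη, hηk⟩)
  have hδγ : δ ⊂ γ := by
    refine (?_ : δ ⊆ γ).ssubset_of_ne (by rintro rfl; omega)
    rcases hδF with rfl | hδF
    · exact Set.empty_subset γ
    · refine (hchain.total hδF hγF).resolve_right fun h => ?_
      have := h1_mono h
      omega
  have hδcore : G.IsCore δ := hδF.elim (fun h => h ▸ isCore_empty) fun h => (hc δ h).2
  refine ⟨γ, hγF, le_antisymm (not_lt.1 fun hlt => ?_) hkγ⟩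
  obtain ⟨η, hη, hδη, hηγ, h1η⟩ := hδcore.exists_isCore_h1_eq_sub_one (hc γ hγF).2 hδγ
  have hflag : G.IsCoreFlagIn ν (insert η F) := by
    refine ⟨Set.mem_insert_of_mem _ hν, ?_, ?_, hchain.insert fun θ hθ _ => ?_⟩
    · rintro (h | h)
      · rw [← h, h1_empty] at h1η
        omega
      · exact hempty h
    · rintro θ (rfl | hθ)
      · exact ⟨hηγ.trans (hc γ hγF).1, hη⟩
      · exact hc θ hθ
    · rcases lt_or_ge (G.h1 θ) k with h | h
      · exact Or.inr ((hleδ θ hθ h).trans hδη)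
      · exact Or.inl (hηγ.trans (hγle θ hθ h))
  have hηF : η ∈ F := hmax _ hflag (Set.subset_insert η F) ▸ Set.mem_insert η F
  have := h1_mono (hγle η hηF (by omega))
  omega

theorem IsMaximalCoreFlagIn.card_eq_h1 {F : Set (Set G.E)} (hF : G.IsMaximalCoreFlagIn ν F) :
    (Nat.card F : ℤ) = G.h1 ν := by
  have h : 0 ≤ G.h1 ν := h1_empty.symm.trans_le (h1_mono (Set.empty_subset ν))
  rw [← Nat.card_image_of_injOn hF.1.injOn_h1, hF.image_h1, Nat.card_eq_fintype_card,
    Fintype.card_ofFinset, Int.card_Icc]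
  omega

end Multigraph

/-- every maximal flag of core subgraphs
`∅ ⊊ Γ₁ ⊊ ⋯ ⊊ Γ_n = Γ` of a connected core multigraph `Γ` has exactly
`n = h1(Γ)` terms. -/
theorem maximal_core_flag_card (G : Multigraph) (hG : G.Connected)
    (hcore : G.IsCore Set.univ) (F : Set (Set G.E)) (hF : G.IsMaximalCoreFlag F) :
    (Nat.card F : ℤ) = G.h1 Set.univ := by
  exact hF.card_eq_h1
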